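/- Let n ≥ 17 be an even natural number. Then the optimum value of the subtour LP for the instance G(n, √(n−1)) equals 3n − 4 + 3√(n−1) + √n. -/

import Mathlib

open Real Filter Finset

noncomputable section

/-- Euclidean distance between two points of the plane. -/
def eucl (p q : ℝ × ℝ) : ℝ := Real.sqrt ((p.1 - q.1) ^ 2 + (p.2 - q.2) ^ 2)

/-- The points of the Euclidean TSP instance `G(n,d)`: the `3n` points
`(i, j·d)` for `i = 1,…,n` and `j = 1,2,3`, indexed by `Fin n × Fin 3`. -/
def pt (n : ℕ) (d : ℝ) (p : Fin n × Fin 3) : ℝ × ℝ :=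
  ((p.1.val : ℝ) + 1, ((p.2.val : ℝ) + 1) * d)

/-- A TSP tour of `G(n,d)`: a cyclic listing of all `3n` points (a Hamiltonian
cycle), given as a sequence `t` that hits every point exactly once in
positions `0,…,3n−1` and returns to its start at position `3n`. -/
def IsTour (n : ℕ) (t : ℕ → Fin n × Fin 3) : Prop :=
  Function.Bijective (fun i : Fin (3 * n) => t i) ∧ t (3 * n) = t 0

/-- The length of a TSP tour: the sum of the Euclidean distances between
consecutive points of the cycle. -/
def tourLength (n : ℕ) (d : ℝ) (t : ℕ → Fin n × Fin 3) : ℝ :=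
  ∑ i ∈ Finset.range (3 * n), eucl (pt n d (t i)) (pt n d (t (i + 1)))

/-- Feasibility for the subtour LP on the points of `G(n,d)`, with symmetric
edge variables `x i j`: degree constraints `∑_{j≠i} x i j = 2`, subtour
elimination constraints (each unordered pair is counted twice in the double
sum, whence the factor 2), and `0 ≤ x i j ≤ 1`. -/
def SubtourLPFeasible (n : ℕ) (x : Fin n × Fin 3 → Fin n × Fin 3 → ℝ) : Prop :=
  (∀ i j, x i j = x j i) ∧
  (∀ i, x i i = 0) ∧
  (∀ i j, 0 ≤ x i j ∧ x i j ≤ 1) ∧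
  (∀ i, ∑ j, x i j = 2) ∧
  (∀ S : Finset (Fin n × Fin 3), S.Nonempty → S ≠ Finset.univ →
      ∑ i ∈ S, ∑ j ∈ S, x i j ≤ 2 * ((S.card : ℝ) - 1))

/-- The objective value of the subtour LP for `G(n,d)`: each unordered pair
appears twice in the double sum, whence the factor `1/2`. -/
def lpValue (n : ℕ) (d : ℝ) (x : Fin n × Fin 3 → Fin n × Fin 3 → ℝ) : ℝ :=
  (1 / 2) * ∑ i, ∑ j, eucl (pt n d i) (pt n d j) * x i j

/-- The length of a shortest TSP tour of `G(n,d)`. -/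
def optTour (n : ℕ) (d : ℝ) : ℝ :=
  sInf {L | ∃ t, IsTour n t ∧ tourLength n d t = L}

/-- The optimum value of the subtour LP for `G(n,d)`. -/
def optLP (n : ℕ) (d : ℝ) : ℝ :=
  sInf {L | ∃ x, SubtourLPFeasible n x ∧ lpValue n d x = L}

/-- `zcost d z` is the length of a z-shaped path covering `z` points in the
middle row of `G(n,d)`. -/
def zcost (d x : ℝ) : ℝ := 2 * (x - 1) + Real.sqrt ((x - 1) ^ 2 + d ^ 2)

/-! ### Weak duality -/

/-- Weak duality for the subtour LP: vertex potentials `y` and nonnegative weights `w` on proper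
vertex sets that together underestimate every edge length give a lower bound on the LP value. -/
theorem le_lpValue_of_dual {n : ℕ} {d : ℝ} {x : Fin n × Fin 3 → Fin n × Fin 3 → ℝ}
    (hx : SubtourLPFeasible n x) {ι : Type*} [Fintype ι]
    (S : ι → Finset (Fin n × Fin 3)) (w : ι → ℝ) (y : Fin n × Fin 3 → ℝ)
    (hw : ∀ k, 0 ≤ w k) (hS : ∀ k, (S k).Nonempty) (hS' : ∀ k, S k ≠ Finset.univ)
    (h : ∀ i j, i ≠ j →
      y i + y j - ∑ k, (if i ∈ S k ∧ j ∈ S k then w k else 0) ≤ eucl (pt n d i) (pt n d j)) :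
    2 * ∑ i, y i - ∑ k, w k * ((S k).card - 1) ≤ lpValue n d x := by
  obtain ⟨hsymm, hdiag, hbd, hdeg, hsub⟩ := hx
  have h1 : ∑ i, ∑ j, (y i + y j - ∑ k, (if i ∈ S k ∧ j ∈ S k then w k else 0)) * x i j
      ≤ ∑ i, ∑ j, eucl (pt n d i) (pt n d j) * x i j := by
    refine Finset.sum_le_sum fun i _ => Finset.sum_le_sum fun j _ => ?_
    rcases eq_or_ne i j with rfl | hij
    · simp [hdiag]
    · exact mul_le_mul_of_nonneg_right (h i j hij) (hbd i j).1
  have h2 : ∑ i, ∑ j, y i * x i j = 2 * ∑ i, y i := by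
    simp_rw [← Finset.mul_sum, hdeg, Finset.mul_sum, mul_comm]
  have h3 : ∑ i, ∑ j, y j * x i j = 2 * ∑ i, y i := by
    rw [Finset.sum_comm, ← h2]
    simp_rw [hsymm]
  have h4 : ∑ i, ∑ j, (∑ k, (if i ∈ S k ∧ j ∈ S k then w k else 0)) * x i j
      = ∑ k, w k * ∑ i ∈ S k, ∑ j ∈ S k, x i j := by
    have (k : ι) : w k * ∑ i ∈ S k, ∑ j ∈ S k, x i j
        = ∑ i, ∑ j, (if i ∈ S k ∧ j ∈ S k then w k else 0) * x i j := by
      simp [ite_and, Finset.mul_sum, Finset.sum_ite_mem, ite_mul]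
    simp_rw [this, Finset.sum_mul]
    rw [Finset.sum_comm' (t' := Finset.univ) (s' := fun _ => Finset.univ) (by simp)]
    rw [Finset.sum_comm (s := (Finset.univ : Finset ι))]
    rw [Finset.sum_comm]
    exact Finset.sum_congr rfl fun i _ => Finset.sum_comm
  have h5 : ∑ k, w k * ∑ i ∈ S k, ∑ j ∈ S k, x i j
      ≤ ∑ k, w k * (2 * (((S k).card : ℝ) - 1)) :=
    Finset.sum_le_sum fun k _ => mul_le_mul_of_nonneg_left (hsub _ (hS k) (hS' k)) (hw k)
  have h6 : ∑ k, w k * (2 * (((S k).card : ℝ) - 1)) = 2 * ∑ k, w k * (((S k).card : ℝ) - 1) := by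
    rw [Finset.mul_sum]
    exact Finset.sum_congr rfl fun k _ => by ring
  simp_rw [sub_mul, add_mul, Finset.sum_sub_distrib, Finset.sum_add_distrib] at h1
  rw [h2, h3, h4] at h1
  rw [lpValue]
  linarith

/-! ### Distances in the grid -/

theorem abs_le_eucl_fst (p q : ℝ × ℝ) : |p.1 - q.1| ≤ eucl p q :=
  Real.abs_le_sqrt (by nlinarith [sq_nonneg (p.2 - q.2)])

theorem abs_le_eucl_snd (p q : ℝ × ℝ) : |p.2 - q.2| ≤ eucl p q :=
  Real.abs_le_sqrt (by nlinarith [sq_nonneg (p.1 - q.1)])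

theorem eucl_comm (p q : ℝ × ℝ) : eucl p q = eucl q p := by
  rw [eucl, eucl]; ring_nf

theorem one_le_abs_cast_sub {n : ℕ} {a b : Fin n} (h : a ≠ b) : (1 : ℝ) ≤ |(a.val : ℝ) - b.val| := by
  have : a.val ≠ b.val := fun e => h (Fin.ext e)
  have h1 : (1 : ℤ) ≤ |(a.val : ℤ) - b.val| := Int.one_le_abs (by omega)
  exact_mod_cast h1

theorem abs_sub_le_eucl_pt {n : ℕ} (d : ℝ) (p q : Fin n × Fin 3) :
    |(p.1.val : ℝ) - q.1.val| ≤ eucl (pt n d p) (pt n d q) := by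
  simpa [pt] using abs_le_eucl_fst (pt n d p) (pt n d q)

theorem one_le_eucl_pt {n : ℕ} (d : ℝ) {p q : Fin n × Fin 3} (h : p.1 ≠ q.1) :
    1 ≤ eucl (pt n d p) (pt n d q) :=
  (one_le_abs_cast_sub h).trans (abs_sub_le_eucl_pt d p q)

theorem two_le_eucl_pt {n : ℕ} (d : ℝ) {p q : Fin n × Fin 3}
    (h : p.1.val + 2 ≤ q.1.val ∨ q.1.val + 2 ≤ p.1.val) :
    2 ≤ eucl (pt n d p) (pt n d q) := by
  refine le_trans ?_ (abs_sub_le_eucl_pt d p q)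
  rcases h with h | h
  · have : (p.1.val : ℝ) + 2 ≤ q.1.val := by exact_mod_cast h
    exact le_trans (by linarith) (neg_le_abs _)
  · have : (q.1.val : ℝ) + 2 ≤ p.1.val := by exact_mod_cast h
    exact le_trans (by linarith) (le_abs_self _)

theorem mul_abs_sub_le_eucl_pt {n : ℕ} {d : ℝ} (hd : 0 ≤ d) (p q : Fin n × Fin 3) :
    |(p.2.val : ℝ) - q.2.val| * d ≤ eucl (pt n d p) (pt n d q) := by
  have := abs_le_eucl_snd (pt n d p) (pt n d q)
  simp only [pt] at this
  rwa [← sub_mul, add_sub_add_right_eq_sub, abs_mul, abs_of_nonneg hd] at this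

theorem sqrt_le_eucl_pt {n : ℕ} (d : ℝ) {p q : Fin n × Fin 3} (h : p.1 ≠ q.1)
    (h2 : |(p.2.val : ℝ) - q.2.val| = 1) :
    Real.sqrt (1 + d ^ 2) ≤ eucl (pt n d p) (pt n d q) := by
  refine Real.sqrt_le_sqrt ?_
  have h1 := one_le_abs_cast_sub h
  simp only [pt]
  rw [← sub_mul, add_sub_add_right_eq_sub, add_sub_add_right_eq_sub, mul_pow,
    ← sq_abs ((p.2.val : ℝ) - q.2.val), h2, ← sq_abs ((p.1.val : ℝ) - q.1.val)]
  nlinarith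

/-! ### The dual solution -/

/-- The indicator of the two end columns. -/
def endInd (N : ℕ) (a : Fin (N + 2)) : ℝ :=
  (if a = 0 then 1 else 0) + (if a = Fin.last (N + 1) then 1 else 0)

theorem endInd_nonneg (N : ℕ) (a : Fin (N + 2)) : 0 ≤ endInd N a := by
  unfold endInd; positivity

theorem endInd_le_one (N : ℕ) (a : Fin (N + 2)) : endInd N a ≤ 1 := by
  unfold endInd
  split_ifs with h1 h2
  · simp [h1, Fin.ext_iff] at h2
  all_goals norm_num

theorem sum_endInd (N : ℕ) : ∑ a, endInd N a = 2 := by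
  simp only [endInd, Finset.sum_add_distrib, Finset.sum_ite_eq', Finset.mem_univ, if_true]
  norm_num

theorem le_mul_endInd {N : ℕ} {ε : ℝ} (hε : 0 ≤ ε) (a : Fin (N + 2))
    (h : a = 0 ∨ a = Fin.last (N + 1)) : ε ≤ ε * endInd N a := by
  refine le_mul_of_one_le_right hε ?_
  unfold endInd
  rcases h with rfl | rfl <;> simp

/-- Two distinct columns at distance `c` are either far enough apart to pay for `2 * ε`, or
adjacent, in which case each end column among them lies in an end pair containing both. -/
theorem mul_endInd_add_le {N : ℕ} {ε c : ℝ} (hε : 0 ≤ ε) {a b : Fin (N + 2)} (hab : a ≠ b)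
    (h : 1 + 2 * ε ≤ c ∨ ¬(a.val + 2 ≤ b.val ∨ b.val + 2 ≤ a.val) ∧ 1 ≤ c) :
    1 + ε * endInd N a + ε * endInd N b ≤ c +
      ((if (a = 0 ∨ a = 1) ∧ (b = 0 ∨ b = 1) then ε else 0) +
        if (a = (Fin.last N).castSucc ∨ a = Fin.last (N + 1)) ∧
          (b = (Fin.last N).castSucc ∨ b = Fin.last (N + 1)) then ε else 0) := by
  rcases h with h | ⟨hadj, hc⟩
  · have ea1 := mul_le_of_le_one_right hε (endInd_le_one N a)
    have eb1 := mul_le_of_le_one_right hε (endInd_le_one N b)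
    have h1 : 0 ≤ if (a = 0 ∨ a = 1) ∧ (b = 0 ∨ b = 1) then ε else 0 := by positivity
    have h2 : 0 ≤ if (a = (Fin.last N).castSucc ∨ a = Fin.last (N + 1)) ∧
      (b = (Fin.last N).castSucc ∨ b = Fin.last (N + 1)) then ε else 0 := by positivity
    linarith
  · have ha := a.isLt
    have hb := b.isLt
    rw [Ne, Fin.ext_iff] at hab
    simp only [endInd, Fin.ext_iff, Fin.val_zero, Fin.val_one, Fin.val_last, Fin.val_castSucc]
    split_ifs <;> first | omega | linarith

/-- The vertex potentials of the dual solution. -/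
def dualY (N : ℕ) (d ε : ℝ) (p : Fin (N + 2) × Fin 3) : ℝ :=
  if p.2 = 1 then 1 / 2 + ε / 2 - ε * endInd N p.1 else d - 1 / 2 - ε / 2 + ε * endInd N p.1

theorem sum_dualY (N : ℕ) (d ε : ℝ) :
    ∑ p, dualY N d ε p = (N + 2) * (2 * d - 1 / 2 - ε / 2) + 2 * ε := by
  simp only [Fintype.sum_prod_type, Fin.sum_univ_three, dualY]
  simp [Finset.sum_add_distrib, Finset.sum_sub_distrib, ← Finset.mul_sum, sum_endInd]
  ring

/-- The vertex sets carrying the dual solution: the two outer rows, the interior of the middle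
row, and the end edges of the outer rows. -/
def dualS (N : ℕ) : Fin 7 → Finset (Fin (N + 2) × Fin 3) :=
  ![Finset.univ ×ˢ {0}, Finset.univ ×ˢ {2}, {0, Fin.last (N + 1)}ᶜ ×ˢ {1},
    {0, 1} ×ˢ {0}, {0, 1} ×ˢ {2},
    {(Fin.last N).castSucc, Fin.last (N + 1)} ×ˢ {0},
    {(Fin.last N).castSucc, Fin.last (N + 1)} ×ˢ {2}]

/-- The weights of the sets `dualS`. -/
def dualW (d ε : ℝ) : Fin 7 → ℝ :=
  ![2 * d - 2 - ε, 2 * d - 2 - ε, ε, ε, ε, ε, ε]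

theorem dualW_nonneg {d ε : ℝ} (hε : 0 ≤ ε) (h : ε ≤ 2 * d - 2) (k : Fin 7) :
    0 ≤ dualW d ε k := by
  fin_cases k <;> simp [dualW] <;> linarith

theorem dualS_card (N : ℕ) (k : Fin 7) :
    (dualS N k).card = ![N + 2, N + 2, N, 2, 2, 2, 2] k := by
  have h1 : ({0, 1} : Finset (Fin (N + 2))).card = 2 := Finset.card_pair (by simp)
  have h2 : ({(Fin.last N).castSucc, Fin.last (N + 1)} : Finset (Fin (N + 2))).card = 2 :=
    Finset.card_pair (by simp [Fin.ext_iff])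
  have h3 : ({0, Fin.last (N + 1)} : Finset (Fin (N + 2))).card = 2 :=
    Finset.card_pair (by simp [Fin.ext_iff])
  fin_cases k <;> simp [dualS, h1, h2, h3, Finset.card_compl]

theorem dualS_nonempty {N : ℕ} (hN : 1 ≤ N) (k : Fin 7) : (dualS N k).Nonempty := by
  rw [← Finset.card_pos, dualS_card]
  fin_cases k <;> simp
  omega

theorem dualS_ne_univ (N : ℕ) (k : Fin 7) : dualS N k ≠ Finset.univ := by
  rw [Ne, ← Finset.card_eq_iff_eq_univ, dualS_card]
  fin_cases k <;> simp <;> omega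

theorem sum_dualW (N : ℕ) (d ε : ℝ) :
    ∑ k, dualW d ε k * ((dualS N k).card - 1)
      = 2 * (2 * d - 2 - ε) * (N + 1) + ε * (N - 1) + 4 * ε := by
  simp [Fin.sum_univ_succ, dualS_card, dualW]
  ring

theorem dual_feasible {N : ℕ} {d ε : ℝ} (hd : 0 ≤ d)
    (hε : 0 ≤ ε) (hε' : ε ≤ 1 / 2) (hdε : Real.sqrt (1 + d ^ 2) = d + ε)
    (p q : Fin (N + 2) × Fin 3) (hpq : p ≠ q) :
    dualY N d ε p + dualY N d ε q
      - ∑ k, (if p ∈ dualS N k ∧ q ∈ dualS N k then dualW d ε k else 0)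
      ≤ eucl (pt (N + 2) d p) (pt (N + 2) d q) := by
  obtain ⟨a, r⟩ := p
  obtain ⟨b, s⟩ := q
  have ea := mul_nonneg hε (endInd_nonneg N a)
  have eb := mul_nonneg hε (endInd_nonneg N b)
  have ea1 := mul_le_of_le_one_right hε (endInd_le_one N a)
  have eb1 := mul_le_of_le_one_right hε (endInd_le_one N b)
  have outer (r : Fin 3) (h : a ≠ b) := mul_endInd_add_le hε h (by
    rcases em (a.val + 2 ≤ b.val ∨ b.val + 2 ≤ a.val) with hab | hab
    · exact Or.inl ((by linarith : 1 + 2 * ε ≤ 2).trans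
        (two_le_eucl_pt d (p := (a, r)) (q := (b, r)) hab))
    · exact Or.inr ⟨hab, one_le_eucl_pt d (p := (a, r)) (q := (b, r)) h⟩)
  have cross (r s : Fin 3) (h : |(r.val : ℝ) - s.val| = 1) :
      a = b ∧ d ≤ eucl (pt (N + 2) d (a, r)) (pt (N + 2) d (b, s))
        ∨ d + ε ≤ eucl (pt (N + 2) d (a, r)) (pt (N + 2) d (b, s)) := by
    rcases eq_or_ne a b with rfl | hab
    · exact Or.inl ⟨rfl, by simpa [h] using mul_abs_sub_le_eucl_pt hd (a, r) (a, s)⟩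
    · exact Or.inr (hdε ▸ sqrt_le_eucl_pt d (p := (a, r)) (q := (b, s)) hab h)
  have far (r s : Fin 3) (h : |(r.val : ℝ) - s.val| = 2) :
      2 * d ≤ eucl (pt (N + 2) d (a, r)) (pt (N + 2) d (b, s)) := by
    simpa [h] using mul_abs_sub_le_eucl_pt hd (a, r) (b, s)
  have hne (r : Fin 3) (h : ((a, r) : Fin (N + 2) × Fin 3) ≠ (b, r)) : a ≠ b :=
    fun e => h (by rw [e])
  simp only [Fin.sum_univ_succ, dualS, dualW, dualY]
  fin_cases r <;> fin_cases s <;> simp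
  · linarith [outer 0 (hne 0 hpq)]
  · rcases cross 0 1 (by norm_num) with ⟨rfl, h⟩ | h <;> linarith
  · linarith [far 0 2 (by norm_num)]
  · rcases cross 1 0 (by norm_num) with ⟨rfl, h⟩ | h <;> linarith
  · have h := one_le_eucl_pt d (p := (a, 1)) (q := (b, 1)) (hne 1 hpq)
    have ha := le_mul_endInd hε a
    have hb := le_mul_endInd hε b
    split_ifs with hab
    · linarith
    · by_cases h0 : a = 0 ∨ a = Fin.last (N + 1)
      · linarith [ha h0]
      · have : b = 0 ∨ b = Fin.last (N + 1) := by tauto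
        linarith [hb this]
  · rcases cross 1 2 (by norm_num) with ⟨rfl, h⟩ | h <;> linarith
  · linarith [far 2 0 (by norm_num)]
  · rcases cross 2 1 (by norm_num) with ⟨rfl, h⟩ | h <;> linarith
  · linarith [outer 2 (hne 2 hpq)]

/-! ### The primal solution -/

/-- The adjacency matrix of the edge joining `a` and `b`. -/
def edgeInd {V : Type*} [DecidableEq V] (a b i j : V) : ℝ :=
  (if i = a ∧ j = b then 1 else 0) + (if i = b ∧ j = a then 1 else 0)

theorem edgeInd_nonneg {V : Type*} [DecidableEq V] (a b i j : V) : 0 ≤ edgeInd a b i j := by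
  unfold edgeInd; positivity

theorem edgeInd_symm {V : Type*} [DecidableEq V] (a b i j : V) :
    edgeInd a b i j = edgeInd a b j i := by
  unfold edgeInd
  simp only [and_comm, add_comm]

theorem sum_edgeInd {V : Type*} [DecidableEq V] [Fintype V] (a b i : V) :
    ∑ j, edgeInd a b i j = (if i = a then 1 else 0) + (if i = b then 1 else 0) := by
  simp [edgeInd, Finset.sum_add_distrib, ite_and]

theorem sum_mul_edgeInd {V : Type*} [DecidableEq V] [Fintype V] (f : V → V → ℝ) (a b : V) :
    ∑ i, ∑ j, f i j * edgeInd a b i j = f a b + f b a := by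
  simp [edgeInd, Finset.sum_add_distrib, ite_and, mul_add]

/-- The optimum LP solution on `G(N + 2, d)`. -/
def lpSol (N : ℕ) (i j : Fin (N + 2) × Fin 3) : ℝ :=
  (∑ r : Fin 3, ∑ k : Fin (N + 1), edgeInd (k.castSucc, r) (k.succ, r) i j)
  + edgeInd (0, 0) (0, 1) i j + edgeInd (Fin.last (N + 1), 0) (Fin.last (N + 1), 1) i j
  + 1 / 2 * (edgeInd (0, 1) (0, 2) i j + edgeInd (1, 1) (0, 2) i j - edgeInd (0, 1) (1, 1) i j)
  + 1 / 2 * (edgeInd (Fin.last (N + 1), 1) (Fin.last (N + 1), 2) i j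
    + edgeInd ((Fin.last N).castSucc, 1) (Fin.last (N + 1), 2) i j
    - edgeInd ((Fin.last N).castSucc, 1) (Fin.last (N + 1), 1) i j)

/-- The total of the symmetric edge function `f` over the edges of `lpSol`. -/
def lpSolSum (N : ℕ) (f : Fin (N + 2) × Fin 3 → Fin (N + 2) × Fin 3 → ℝ) : ℝ :=
  (∑ r : Fin 3, ∑ k : Fin (N + 1), f (k.castSucc, r) (k.succ, r))
  + f (0, 0) (0, 1) + f (Fin.last (N + 1), 0) (Fin.last (N + 1), 1)
  + 1 / 2 * (f (0, 1) (0, 2) + f (1, 1) (0, 2) - f (0, 1) (1, 1))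
  + 1 / 2 * (f (Fin.last (N + 1), 1) (Fin.last (N + 1), 2)
    + f ((Fin.last N).castSucc, 1) (Fin.last (N + 1), 2)
    - f ((Fin.last N).castSucc, 1) (Fin.last (N + 1), 1))

theorem sum_mul_lpSol (N : ℕ) (f : Fin (N + 2) × Fin 3 → Fin (N + 2) × Fin 3 → ℝ)
    (hf : ∀ i j, f i j = f j i) :
    ∑ i, ∑ j, f i j * lpSol N i j = 2 * lpSolSum N f := by
  have key (a b : Fin (N + 2) × Fin 3) : ∑ i, ∑ j, f i j * edgeInd a b i j = 2 * f a b := by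
    rw [sum_mul_edgeInd, hf b a, two_mul]
  have rows : ∑ i, ∑ j, f i j * (∑ r : Fin 3, ∑ k : Fin (N + 1),
      edgeInd ((k.castSucc, r) : Fin (N + 2) × Fin 3) (k.succ, r) i j)
      = 2 * ∑ r : Fin 3, ∑ k : Fin (N + 1), f (k.castSucc, r) (k.succ, r) := by
    simp_rw [← Fintype.sum_prod_type' (f := fun (r : Fin 3) (k : Fin (N + 1)) =>
      edgeInd ((k.castSucc, r) : Fin (N + 2) × Fin 3) (k.succ, r) _ _),
      ← Fintype.sum_prod_type' (f := fun (r : Fin 3) (k : Fin (N + 1)) =>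
      f (k.castSucc, r) (k.succ, r)), Finset.mul_sum]
    simp_rw [← key]
    rw [Finset.sum_comm (s := (Finset.univ : Finset (Fin 3 × Fin (N + 1))))]
    exact Finset.sum_congr rfl fun i _ => Finset.sum_comm
  have half (a b : Fin (N + 2) × Fin 3) :
      ∑ i, ∑ j, f i j * (1 / 2 * edgeInd a b i j) = f a b := by
    simp_rw [mul_left_comm _ (1 / 2 : ℝ), ← Finset.mul_sum, key]
    ring
  simp only [lpSol, lpSolSum, mul_add, mul_sub, Finset.sum_add_distrib, Finset.sum_sub_distrib,
    rows, key, half]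
  ring

theorem sum_castSucc_add_succ {M : ℕ} (f : Fin (M + 1) → ℝ) :
    ∑ k : Fin M, (f k.castSucc + f k.succ) = 2 * ∑ a, f a - f 0 - f (Fin.last M) := by
  rw [Finset.sum_add_distrib]
  linarith [Fin.sum_univ_succ f, Fin.sum_univ_castSucc f]

theorem lpSol_deg (N : ℕ) (i : Fin (N + 2) × Fin 3) : ∑ j, lpSol N i j = 2 := by
  have hrow (r : Fin 3) : ∑ j, ∑ k : Fin (N + 1),
      edgeInd ((k.castSucc, r) : Fin (N + 2) × Fin 3) (k.succ, r) i j
      = 2 * (if i.2 = r then 1 else 0) - (if i = (0, r) then 1 else 0)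
        - (if i = (Fin.last (N + 1), r) then 1 else 0) := by
    rw [Finset.sum_comm]
    simp_rw [sum_edgeInd]
    rw [sum_castSucc_add_succ (fun a => if i = (a, r) then (1 : ℝ) else 0)]
    congr 3
    simp [Prod.ext_iff, ite_and]
  have hone : (if i.2 = 0 then (1 : ℝ) else 0) + (if i.2 = 1 then 1 else 0)
      + (if i.2 = 2 then 1 else 0) = 1 := by
    rw [← Fin.sum_univ_three (fun r => if i.2 = r then (1 : ℝ) else 0)]
    simp
  simp only [lpSol, Finset.sum_add_distrib, Finset.sum_sub_distrib, ← Finset.mul_sum,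
    hrow, sum_edgeInd, Fin.sum_univ_three]
  linarith

theorem lpSol_nonneg (N : ℕ) (i j : Fin (N + 2) × Fin 3) : 0 ≤ lpSol N i j := by
  have hrow (r : Fin 3) (k : Fin (N + 1)) :
      edgeInd ((k.castSucc, r) : Fin (N + 2) × Fin 3) (k.succ, r) i j
      ≤ ∑ k : Fin (N + 1), edgeInd ((k.castSucc, r) : Fin (N + 2) × Fin 3) (k.succ, r) i j :=
    Finset.single_le_sum (f := fun k : Fin (N + 1) =>
      edgeInd ((k.castSucc, r) : Fin (N + 2) × Fin 3) (k.succ, r) i j)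
      (fun k _ => edgeInd_nonneg _ _ _ _) (Finset.mem_univ k)
  have h0 := (edgeInd_nonneg _ _ _ _).trans (hrow 0 0)
  have h2 := (edgeInd_nonneg _ _ _ _).trans (hrow 2 0)
  have h1 := hrow 1 0
  have h1' := hrow 1 (Fin.last N)
  rw [Fin.castSucc_zero, Fin.succ_zero_eq_one] at h1
  rw [Fin.succ_last] at h1'
  rw [lpSol, Fin.sum_univ_three]
  linarith [edgeInd_nonneg ((0, 0) : Fin (N + 2) × Fin 3) (0, 1) i j,
    edgeInd_nonneg ((Fin.last (N + 1), 0) : Fin (N + 2) × Fin 3) (Fin.last (N + 1), 1) i j,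
    edgeInd_nonneg ((0, 1) : Fin (N + 2) × Fin 3) (0, 2) i j,
    edgeInd_nonneg ((1, 1) : Fin (N + 2) × Fin 3) (0, 2) i j,
    edgeInd_nonneg ((Fin.last (N + 1), 1) : Fin (N + 2) × Fin 3) (Fin.last (N + 1), 2) i j,
    edgeInd_nonneg (((Fin.last N).castSucc, 1) : Fin (N + 2) × Fin 3) (Fin.last (N + 1), 2) i j]

theorem lpSol_symm (N : ℕ) (i j : Fin (N + 2) × Fin 3) : lpSol N i j = lpSol N j i := by
  simp only [lpSol, edgeInd_symm _ _ i j]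

/-- Variation along a row dominates that along the columns `0 ≤ a ≤ v ≤ b ≤ M`. -/
theorem chain_le_variation {M : ℕ} (f : Fin (M + 1) → ℝ) {a v b : Fin (M + 1)}
    (hav : a ≤ v) (hvb : v ≤ b) :
    |f 0 - f a| + |f a - f v| + |f v - f b| + |f b - f (Fin.last M)|
      ≤ ∑ k : Fin M, |f k.castSucc - f k.succ| := by
  set g : ℕ → ℝ := fun k => f (Fin.ofNat (M + 1) k)
  have hg (c : Fin (M + 1)) : g c = f c := by simp [g]
  have hsum : ∑ k : Fin M, |f k.castSucc - f k.succ|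
      = ∑ k ∈ Finset.Ico 0 M, dist (g k) (g (k + 1)) := by
    rw [← Finset.range_eq_Ico, ← Fin.sum_univ_eq_sum_range (fun k => dist (g k) (g (k + 1)))]
    refine Finset.sum_congr rfl fun k _ => ?_
    rw [Real.dist_eq, ← hg k.castSucc, ← hg k.succ, Fin.val_castSucc, Fin.val_succ]
  have h1 := dist_le_Ico_sum_dist g (Nat.zero_le a)
  have h2 := dist_le_Ico_sum_dist g (Fin.le_def.1 hav)
  have h3 := dist_le_Ico_sum_dist g (Fin.le_def.1 hvb)
  have h4 := dist_le_Ico_sum_dist g (Nat.lt_succ_iff.1 b.isLt)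
  have e0 : g 0 = f 0 := hg 0
  have eM : g M = f (Fin.last M) := hg (Fin.last M)
  simp only [Real.dist_eq, hg, e0, eM] at h1 h2 h3 h4
  rw [hsum, ← Finset.sum_Ico_consecutive _ (Nat.zero_le b) (Nat.lt_succ_iff.1 b.isLt),
    ← Finset.sum_Ico_consecutive _ (Nat.zero_le v) (Fin.le_def.1 hvb),
    ← Finset.sum_Ico_consecutive _ (Nat.zero_le a) (Fin.le_def.1 hav)]
  simp only [Real.dist_eq]
  linarith

/-- Every cut separating a vertex from the left end of the middle row has capacity at least two,
stated for arbitrary vertex labels `χ`. -/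
theorem two_mul_abs_le_lpSolSum {N : ℕ} (hN : 1 ≤ N) (χ : Fin (N + 2) × Fin 3 → ℝ)
    (p : Fin (N + 2) × Fin 3) :
    2 * |χ (0, 1) - χ p| ≤ lpSolSum N (fun i j => |χ i - χ j|) := by
  have mid {v : Fin (N + 2)} (h1 : 1 ≤ v) (h2 : v ≤ (Fin.last N).castSucc) :=
    chain_le_variation (fun a => χ (a, 1)) h1 h2
  have out (r : Fin 3) (v : Fin (N + 2)) :
      |χ (0, r) - χ (v, r)| + |χ (v, r) - χ (Fin.last (N + 1), r)|
        ≤ ∑ k : Fin (N + 1), |χ (k.castSucc, r) - χ (k.succ, r)| := by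
    have := chain_le_variation (fun a => χ (a, r)) (Fin.zero_le v) (Fin.le_last v)
    simpa using this
  have h1N : (1 : Fin (N + 2)) ≤ (Fin.last N).castSucc := by
    simp [Fin.le_def]
    omega
  have mid1 := mid le_rfl h1N
  simp only [sub_self, abs_zero, add_zero] at mid1
  have t0 := out 0 0
  have t2 := out 2 0
  simp only [sub_self, abs_zero, zero_add] at t0 t2
  obtain ⟨v, r⟩ := p
  have out0 := out 0 v
  have out2 := out 2 v
  have midv : v = 0 ∨ v = Fin.last (N + 1) ∨ 1 ≤ v ∧ v ≤ (Fin.last N).castSucc := by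
    have := v.isLt
    simp only [Fin.ext_iff, Fin.le_def, Fin.val_zero, Fin.val_one, Fin.val_last, Fin.val_castSucc]
    omega
  have mid' := fun h : 1 ≤ v ∧ v ≤ (Fin.last N).castSucc => mid h.1 h.2
  simp only [lpSolSum, Fin.sum_univ_three]
  generalize (∑ k : Fin (N + 1), |χ (k.castSucc, 0) - χ (k.succ, 0)|) = D₀ at *
  generalize (∑ k : Fin (N + 1), |χ (k.castSucc, 1) - χ (k.succ, 1)|) = D₁ at *
  generalize (∑ k : Fin (N + 1), |χ (k.castSucc, 2) - χ (k.succ, 2)|) = D₂ at *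
  have tri (a b c : Fin (N + 2) × Fin 3) : |χ a - χ c| ≤ |χ a - χ b| + |χ b - χ c| :=
    abs_sub_le _ _ _
  have tri' (a b c : Fin (N + 2) × Fin 3) : |χ a - χ c| ≤ |χ a - χ b| + |χ c - χ b| := by
    rw [abs_sub_comm (χ c)]
    exact tri a b c
  have tri'' (a b c : Fin (N + 2) × Fin 3) : |χ a - χ c| ≤ |χ b - χ a| + |χ b - χ c| := by
    rw [abs_sub_comm (χ b) (χ a)]
    exact tri a b c
  have nonneg (a b : Fin (N + 2) × Fin 3) : 0 ≤ |χ a - χ b| := abs_nonneg _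
  set L : Fin (N + 2) := Fin.last (N + 1)
  set L' : Fin (N + 2) := (Fin.last N).castSucc
  have left := tri' (0, 1) (0, 2) (1, 1)
  have left' := tri (0, 1) (1, 1) (0, 2)
  have right := tri' (L', 1) (L, 2) (L, 1)
  have right' := tri'' (L, 1) (L', 1) (L, 2)
  have around : |χ (0, 1) - χ (L, 1)| ≤
      |χ (0, 0) - χ (0, 1)| + |χ (0, 0) - χ (L, 0)| + |χ (L, 0) - χ (L, 1)| := by
    linarith [tri'' (0, 1) (0, 0) (L, 1), tri (0, 0) (L, 0) (L, 1)]
  fin_cases r <;> simp only [Fin.zero_eta, Fin.mk_one, Fin.reduceFinMk]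
  · linarith [tri'' (0, 1) (0, 0) (v, 0), tri (0, 1) (1, 1) (v, 0), tri (1, 1) (L', 1) (v, 0),
      tri (L', 1) (L, 1) (v, 0), tri'' (L, 1) (L, 0) (v, 0),
      abs_sub_comm (χ (v, 0)) (χ (L, 0)), nonneg (0, 2) (L, 2)]
  · rcases midv with rfl | rfl | hv
    · rw [sub_self, abs_zero]
      linarith [nonneg (0, 0) (L, 0), nonneg (0, 2) (L, 2), nonneg (0, 0) (0, 1),
        nonneg (L, 0) (L, 1), nonneg (0, 1) (1, 1), nonneg (1, 1) (L', 1), nonneg (L', 1) (L, 1)]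
    · linarith [tri (0, 1) (1, 1) (L, 1), tri (1, 1) (L', 1) (L, 1), nonneg (0, 2) (L, 2)]
    · linarith [mid' hv, tri (0, 1) (1, 1) (v, 1), tri (0, 1) (L, 1) (v, 1),
        tri'' (L, 1) (L', 1) (v, 1), abs_sub_comm (χ (v, 1)) (χ (L', 1)), nonneg (0, 2) (L, 2)]
  · linarith [tri (0, 1) (0, 2) (v, 2), tri (0, 1) (L, 1) (v, 2), tri (L, 1) (L, 2) (v, 2),
      abs_sub_comm (χ (v, 2)) (χ (L, 2)), nonneg (1, 1) (L', 1)]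

theorem two_le_lpSolSum {N : ℕ} (hN : 1 ≤ N) (S : Finset (Fin (N + 2) × Fin 3))
    (hS : S.Nonempty) (hS' : S ≠ Finset.univ) :
    2 ≤ lpSolSum N
      (fun i j => |(if i ∈ S then (1 : ℝ) else 0) - (if j ∈ S then (1 : ℝ) else 0)|) := by
  obtain ⟨p, hp⟩ := hS
  obtain ⟨q, hq⟩ : ∃ q, q ∉ S := by
    by_contra! h
    exact hS' (Finset.eq_univ_iff_forall.2 h)
  have hp' := two_mul_abs_le_lpSolSum hN (fun i => if i ∈ S then (1 : ℝ) else 0) p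
  have hq' := two_mul_abs_le_lpSolSum hN (fun i => if i ∈ S then (1 : ℝ) else 0) q
  by_cases h : ((0, 1) : Fin (N + 2) × Fin 3) ∈ S
  · simpa [h, hq] using hq'
  · simpa [h, hp] using hp'

theorem lpSol_subtour {N : ℕ} (hN : 1 ≤ N) (S : Finset (Fin (N + 2) × Fin 3))
    (hS : S.Nonempty) (hS' : S ≠ Finset.univ) :
    ∑ i ∈ S, ∑ j ∈ S, lpSol N i j ≤ 2 * ((S.card : ℝ) - 1) := by
  set χ : Fin (N + 2) × Fin 3 → ℝ := fun i => if i ∈ S then 1 else 0 with hχ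
  have hcut := two_le_lpSolSum hN S hS hS'
  have hpair := sum_mul_lpSol N (fun i j => |χ i - χ j|) (fun i j => abs_sub_comm _ _)
  have hdeg : ∑ i, ∑ j, χ i * lpSol N i j = 2 * S.card := by
    simp_rw [← Finset.mul_sum, lpSol_deg, ← Finset.sum_mul]
    simp [hχ, mul_comm]
  have hdeg' : ∑ i, ∑ j, χ j * lpSol N i j = 2 * S.card := by
    rw [Finset.sum_comm, ← hdeg]
    simp_rw [lpSol_symm N]
  have hS2 : 2 * ∑ i ∈ S, ∑ j ∈ S, lpSol N i j = ∑ i, ∑ j,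
      (χ i * lpSol N i j + χ j * lpSol N i j - |χ i - χ j| * lpSol N i j) := by
    have : ∑ i ∈ S, ∑ j ∈ S, lpSol N i j = ∑ i, ∑ j, χ i * χ j * lpSol N i j := by
      simp [hχ, Finset.sum_ite_mem, ite_mul]
    simp_rw [this, Finset.mul_sum]
    refine Finset.sum_congr rfl fun i _ => Finset.sum_congr rfl fun j _ => ?_
    by_cases hi : i ∈ S <;> by_cases hj : j ∈ S <;> (simp [hχ, hi, hj]; try ring)
  simp only [Finset.sum_sub_distrib, Finset.sum_add_distrib] at hS2
  rw [hdeg, hdeg', hpair] at hS2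
  linarith

theorem lpSol_feasible {N : ℕ} (hN : 1 ≤ N) : SubtourLPFeasible (N + 2) (lpSol N) := by
  have hdiag (i : Fin (N + 2) × Fin 3) : lpSol N i i = 0 := by
    refine le_antisymm ?_ (lpSol_nonneg N i i)
    have hne : ({i} : Finset (Fin (N + 2) × Fin 3)) ≠ Finset.univ := by
      rw [Ne, ← Finset.card_eq_iff_eq_univ]
      simp
      omega
    simpa using lpSol_subtour hN {i} (Finset.singleton_nonempty i) hne
  refine ⟨lpSol_symm N, hdiag, fun i j => ⟨lpSol_nonneg N i j, ?_⟩, lpSol_deg N,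
    lpSol_subtour hN⟩
  rcases eq_or_ne i j with rfl | hij
  · simp [hdiag]
  have hne : ({i, j} : Finset (Fin (N + 2) × Fin 3)) ≠ Finset.univ := by
    rw [Ne, ← Finset.card_eq_iff_eq_univ, Finset.card_pair hij]
    simp
    omega
  have h := lpSol_subtour hN {i, j} (Finset.insert_nonempty i _) hne
  rw [Finset.card_pair hij, Finset.sum_pair hij, Finset.sum_pair hij, Finset.sum_pair hij,
    hdiag, hdiag, lpSol_symm N j i] at h
  norm_num at h
  linarith

theorem lpValue_lpSol (N : ℕ) {d : ℝ} (hd : 0 ≤ d) :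
    lpValue (N + 2) d (lpSol N) = 3 * ((N : ℝ) + 2) - 4 + 3 * d + Real.sqrt (1 + d ^ 2) := by
  rw [lpValue, sum_mul_lpSol N _ (fun i j => eucl_comm _ _)]
  have hor (r : Fin 3) (k : Fin (N + 1)) :
      eucl (pt (N + 2) d (k.castSucc, r)) (pt (N + 2) d (k.succ, r)) = 1 := by
    simp [eucl, pt]
  have ver (a : Fin (N + 2)) (r : Fin 2) :
      eucl (pt (N + 2) d (a, r.castSucc)) (pt (N + 2) d (a, r.succ)) = d := by
    simp only [eucl, pt, Fin.val_castSucc, Fin.val_succ]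
    rw [← Real.sqrt_sq hd]
    congr 1
    push_cast
    rw [Real.sqrt_sq hd]
    ring
  have hv0 := fun a => ver a 0
  have hv1 := fun a => ver a 1
  have h0 := hor 1 0
  have hl := hor 1 (Fin.last N)
  have dl : eucl (pt (N + 2) d (1, 1)) (pt (N + 2) d (0, 2)) = Real.sqrt (1 + d ^ 2) := by
    simp only [eucl, pt]
    congr 1
    simp
    ring
  have dr : eucl (pt (N + 2) d ((Fin.last N).castSucc, 1)) (pt (N + 2) d (Fin.last (N + 1), 2))
      = Real.sqrt (1 + d ^ 2) := by
    simp only [eucl, pt]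
    congr 1
    simp
    ring
  simp only [Fin.castSucc_zero, Fin.succ_zero_eq_one, Fin.castSucc_one, Fin.succ_one_eq_two,
    Fin.succ_last] at hv0 hv1 h0 hl
  simp only [lpSolSum, hor, hv0, hv1, h0, hl, dl, dr]
  simp
  ring

/-- For even `n ≥ 17`, the optimum value of the subtour LP for `G(n, √(n−1))`
equals `3n − 4 + 3√(n−1) + √n`. -/
theorem statement14 (n : ℕ) (hn : 17 ≤ n) (hne : Even n) :
    IsLeast {v : ℝ | ∃ x, SubtourLPFeasible n x ∧
        lpValue n (Real.sqrt ((n : ℝ) - 1)) x = v}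
      (3 * (n : ℝ) - 4 + 3 * Real.sqrt ((n : ℝ) - 1) + Real.sqrt (n : ℝ)) := by
  obtain ⟨N, rfl⟩ : ∃ N, n = N + 2 := ⟨n - 2, by omega⟩
  have hN : (15 : ℝ) ≤ N := by exact_mod_cast (by omega : 15 ≤ N)
  set d := Real.sqrt (((N + 2 : ℕ) : ℝ) - 1) with hd
  have hd2 : 1 + d ^ 2 = ((N + 2 : ℕ) : ℝ) := by
    rw [hd, Real.sq_sqrt (by push_cast; linarith)]
    ring
  have hd0 : 0 ≤ d := Real.sqrt_nonneg _
  have hd4 : 4 ≤ d := Real.le_sqrt_of_sq_le (by push_cast; linarith)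
  rw [← hd2]
  constructor
  · refine ⟨lpSol N, lpSol_feasible (by omega), ?_⟩
    rw [lpValue_lpSol N hd0, hd2]
    push_cast
    ring
  · rintro v ⟨x, hx, rfl⟩
    set ε := Real.sqrt (1 + d ^ 2) - d with hε
    have hε0 : 0 ≤ ε := sub_nonneg.2 (Real.le_sqrt_of_sq_le (by linarith))
    have hε1 : ε ≤ 1 / 2 := by
      rw [hε, sub_le_iff_le_add]
      exact Real.sqrt_le_iff.2 ⟨by linarith, by nlinarith⟩
    have h := le_lpValue_of_dual hx (dualS N) (dualW d ε) (dualY N d ε)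
      (dualW_nonneg hε0 (by linarith)) (dualS_nonempty (by omega)) (dualS_ne_univ N)
      (dual_feasible hd0 hε0 hε1 (by rw [hε]; ring))
    rw [sum_dualY, sum_dualW] at h
    rw [hd2] at hε ⊢
    push_cast at hε ⊢
    linarith

end
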